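/- arXiv:1409.4524 — 2 statements merged into one kernel-verified Lean document; each statement's English description precedes it below -/
import Mathlib

section
/- Consider a Barabanov linear switched system with data A, b, c, and let v be a Barabanov norm for it. Let x be a v-extremal solution with x(0) ≠ 0, associated with a measurable u : [0,∞) → [0,1], and let l be a solution of the adjoint system with the same u(·) such that l(t) ∈ ∂v(x(t)) for every t ≥ 0. Then the zeros of the switching function φ(t) := (bᵀl(t))·(cᵀx(t)) are isolated, and both t ↦ bᵀl(t) and t ↦ cᵀx(t) change sign infinitely many times: for every T ≥ 0 there exist t₁, t₂ > T with bᵀl(t₁) > 0 > bᵀl(t₂), and there exist t₃, t₄ > T with cᵀx(t₃) > 0 > cᵀx(t₄). -/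
open MeasureTheory Filter Topology RealInnerProductSpace Matrix

noncomputable section

abbrev Vec3 := EuclideanSpace ℝ (Fin 3)

def mulE (A : Matrix (Fin 3) (Fin 3) ℝ) (y : Vec3) : Vec3 :=
  Matrix.toEuclideanLin A y

/-- A real matrix is Hurwitz if all its complex eigenvalues have negative real part. -/
def IsHurwitz (A : Matrix (Fin 3) (Fin 3) ℝ) : Prop :=
  ∀ μ : ℂ, (A.map (fun r => (r : ℂ))).charpoly.IsRoot μ → μ.re < 0

/-- The rank-one matrix `b cᵀ`. -/
def bcMat (b c : Vec3) : Matrix (Fin 3) (Fin 3) ℝ :=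
  Matrix.vecMulVec (fun i => b i) (fun i => c i)

/-- `x` is a solution of the Barabanov linear switched system
`x' = A x + u(t) b (cᵀ x)` with switching signal `u`. -/
def IsBSolWith (A : Matrix (Fin 3) (Fin 3) ℝ) (b c : Vec3) (u : ℝ → ℝ)
    (x : ℝ → Vec3) : Prop :=
  Measurable u ∧ (∀ t, u t ∈ Set.Icc (0:ℝ) 1) ∧ ContinuousOn x (Set.Ici 0) ∧
    ∀ t ≥ (0:ℝ), x t = x 0 + ∫ s in (0:ℝ)..t, (mulE A (x s) + (u s * ⟪c, x s⟫) • b)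

/-- `l` is a solution of the adjoint system `l' = -Aᵀ l - u(t) c (bᵀ l)`. -/
def IsBAdjWith (A : Matrix (Fin 3) (Fin 3) ℝ) (b c : Vec3) (u : ℝ → ℝ)
    (l : ℝ → Vec3) : Prop :=
  ContinuousOn l (Set.Ici 0) ∧
    ∀ t ≥ (0:ℝ), l t = l 0 - ∫ s in (0:ℝ)..t, (mulE (Aᵀ) (l s) + (u s * ⟪b, l s⟫) • c)

/-- The data `(A, b, c)` defines a Barabanov linear switched system:
`A` and `A + b cᵀ` are Hurwitz, the pairs `(A, b)` and `(Aᵀ, c)` are controllable and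
the largest Lyapunov exponent of the system is zero. -/
def IsBarabanovData (A : Matrix (Fin 3) (Fin 3) ℝ) (b c : Vec3) : Prop :=
  IsHurwitz A ∧ IsHurwitz (A + bcMat b c) ∧
    LinearIndependent ℝ ![b, mulE A b, mulE A (mulE A b)] ∧
    LinearIndependent ℝ ![c, mulE (Aᵀ) c, mulE (Aᵀ) (mulE (Aᵀ) c)] ∧
    sSup {r : EReal | ∃ u x, IsBSolWith A b c u x ∧ x 0 ≠ 0 ∧
        r = limsup (fun t => ((Real.log ‖x t‖ / t : ℝ) : EReal)) atTop} = 0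

def IsBNorm (v : Vec3 → ℝ) : Prop :=
  (∀ x, v x = 0 ↔ x = 0) ∧ (∀ (a : ℝ) (x : Vec3), v (a • x) = |a| * v x) ∧
    ∀ x y, v (x + y) ≤ v x + v y

/-- A Barabanov norm for the Barabanov linear switched system. -/
def IsBBarabanov (A : Matrix (Fin 3) (Fin 3) ℝ) (b c : Vec3) (v : Vec3 → ℝ) : Prop :=
  IsBNorm v ∧
    (∀ u x, IsBSolWith A b c u x → ∀ t ≥ (0:ℝ), v (x t) ≤ v (x 0)) ∧
    ∀ y : Vec3, ∃ u x, IsBSolWith A b c u x ∧ x 0 = y ∧ ∀ t ≥ (0:ℝ), v (x t) = v y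

def subdiff3 (v : Vec3 → ℝ) (x : Vec3) : Set Vec3 :=
  {l | ⟪l, x⟫ = v x ∧ ∀ y, ⟪l, y⟫ ≤ v y}

section Feedback

variable {E : Type*} [NormedAddCommGroup E] [InnerProductSpace ℝ E]

/-- A globally continuous curve which, for nonnegative times, solves
`f' = L f + u(t) ⟪p, f⟫ q` with `u` measurable and `[0,1]`-valued. -/
structure IsFeedbackSol (L : E →L[ℝ] E) (q p : E) (u : ℝ → ℝ) (f : ℝ → E) : Prop where
  measurable : Measurable u
  mem_Icc : ∀ t, u t ∈ Set.Icc (0 : ℝ) 1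
  continuous : Continuous f
  eq_integral : ∀ t ≥ (0 : ℝ), f t = f 0 + ∫ s in (0 : ℝ)..t, (L (f s) + (u s * ⟪p, f s⟫) • q)

/-- A continuous curve on `[0,∞)` solving the integral equation, frozen at its initial value for
negative times, is a feedback solution. -/
lemma IsFeedbackSol.of_continuousOn {L : E →L[ℝ] E} {q p : E} {u : ℝ → ℝ} {f : ℝ → E}
    (hu : Measurable u) (hmem : ∀ t, u t ∈ Set.Icc (0 : ℝ) 1) (hf : ContinuousOn f (Set.Ici 0))
    (heq : ∀ t ≥ (0 : ℝ), f t = f 0 + ∫ s in (0 : ℝ)..t, (L (f s) + (u s * ⟪p, f s⟫) • q)) :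
    IsFeedbackSol L q p u (fun t => f (max t 0)) where
  measurable := hu
  mem_Icc := hmem
  continuous := hf.comp_continuous (by fun_prop) fun t => le_max_right t 0
  eq_integral t ht := by
    have hcongr : ∫ s in (0 : ℝ)..t, (L (f (max s 0)) + (u s * ⟪p, f (max s 0)⟫) • q) =
        ∫ s in (0 : ℝ)..t, (L (f s) + (u s * ⟪p, f s⟫) • q) := by
      refine intervalIntegral.integral_congr fun s hs => ?_
      rw [Set.uIcc_of_le ht] at hs
      simp only [max_eq_left hs.1]
    simp only [max_eq_left ht, max_self, hcongr]
    exact heq t ht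

/-- A Borel function with values in `[0,1]` is integrable on bounded intervals. -/
lemma intervalIntegrable_of_mem_Icc {u : ℝ → ℝ} (hu : Measurable u)
    (hmem : ∀ t, u t ∈ Set.Icc (0 : ℝ) 1) (a b : ℝ) : IntervalIntegrable u volume a b := by
  refine (intervalIntegrable_const (c := (1 : ℝ))).mono_fun hu.aestronglyMeasurable ?_
  filter_upwards with t
  rw [Real.norm_eq_abs, abs_of_nonneg (hmem t).1, norm_one]
  exact (hmem t).2

/-- An estimate for the increment of a primitive whose density is close to an affine function. -/
lemma abs_integral_sub_affine_le {g : ℝ → ℝ} {a t k m M : ℝ} (hg : IntervalIntegrable g volume a t)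
    (hM : ∀ s ∈ Set.uIcc a t, |g s - (m + k * (s - a))| ≤ M) :
    |(∫ s in a..t, g s) - (m * (t - a) + k * (t - a) ^ 2 / 2)| ≤ M * |t - a| := by
  have hP : Continuous fun s : ℝ => m + k * (s - a) := by fun_prop
  have hprim : ∫ s in a..t, (m + k * (s - a)) = m * (t - a) + k * (t - a) ^ 2 / 2 := by
    rw [intervalIntegral.integral_eq_sub_of_hasDerivAt
      (f := fun s => m * (s - a) + k * (s - a) ^ 2 / 2) (f' := fun s => m + k * (s - a)) _
      (hP.intervalIntegrable _ _)]
    · ring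
    · intro s _
      have h1 : HasDerivAt (fun s : ℝ => s - a) 1 s := (hasDerivAt_id s).sub_const a
      refine ((h1.const_mul m).add (((h1.pow 2).const_mul k).div_const 2)).congr_deriv ?_
      norm_num
      ring
  rw [← hprim, ← intervalIntegral.integral_sub hg (hP.intervalIntegrable _ _), ← Real.norm_eq_abs]
  exact intervalIntegral.norm_integral_le_of_norm_le_const fun s hs =>
    hM s (Set.uIoc_subset_uIcc hs)

namespace IsFeedbackSol

variable {L : E →L[ℝ] E} {q p : E} {u : ℝ → ℝ} {f : ℝ → E}

lemma neg (h : IsFeedbackSol L q p u f) : IsFeedbackSol L q p u (fun t => -f t) where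
  measurable := h.measurable
  mem_Icc := h.mem_Icc
  continuous := h.continuous.neg
  eq_integral t ht := by
    conv_lhs => rw [h.eq_integral t ht]
    rw [neg_add, ← intervalIntegral.integral_neg]
    congr 2
    ext s
    simp only [map_neg, inner_neg_right, mul_neg, neg_smul, neg_add]

lemma intervalIntegrable_feedback (h : IsFeedbackSol L q p u f) (a b : ℝ) :
    IntervalIntegrable (fun s => u s * ⟪p, f s⟫) volume a b :=
  (intervalIntegrable_of_mem_Icc h.measurable h.mem_Icc a b).mul_continuousOn
    (continuous_const.inner h.continuous).continuousOn

lemma intervalIntegrable (h : IsFeedbackSol L q p u f) (a b : ℝ) :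
    IntervalIntegrable (fun s => L (f s) + (u s * ⟪p, f s⟫) • q) volume a b :=
  ((L.continuous.comp h.continuous).intervalIntegrable a b).add
    ((h.intervalIntegrable_feedback a b).smul_continuousOn continuousOn_const)

lemma sub_eq_integral (h : IsFeedbackSol L q p u f) {s t : ℝ} (hs : 0 ≤ s) (ht : 0 ≤ t) :
    f t - f s = ∫ r in s..t, (L (f r) + (u r * ⟪p, f r⟫) • q) := by
  rw [h.eq_integral t ht, h.eq_integral s hs, add_sub_add_left_eq_sub,
    intervalIntegral.integral_interval_sub_left (h.intervalIntegrable _ _)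
      (h.intervalIntegrable _ _)]

lemma intervalIntegrable_inner (h : IsFeedbackSol L q p u f) (k : E) (a b : ℝ) :
    IntervalIntegrable (fun s => ⟪k, L (f s)⟫ + u s * ⟪p, f s⟫ * ⟪k, q⟫) volume a b :=
  ((continuous_const.inner (L.continuous.comp h.continuous)).intervalIntegrable a b).add
    ((h.intervalIntegrable_feedback a b).mul_const _)

lemma inner_sub_eq_integral [CompleteSpace E] (h : IsFeedbackSol L q p u f) (k : E) {s t : ℝ}
    (hs : 0 ≤ s) (ht : 0 ≤ t) :
    ⟪k, f t⟫ - ⟪k, f s⟫ = ∫ r in s..t, (⟪k, L (f r)⟫ + u r * ⟪p, f r⟫ * ⟪k, q⟫) := by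
  rw [← inner_sub_right, h.sub_eq_integral hs ht, ← innerSL_apply_apply ℝ k,
    ← ContinuousLinearMap.intervalIntegral_comp_comm _ (h.intervalIntegrable _ _)]
  congr 1
  ext r
  simp [inner_add_right, inner_smul_right]

/-- At a zero of the output `⟪p, f⟫`, every scalar component of a feedback solution is
differentiable along `[0,∞)`. -/
lemma abs_inner_sub_sub_le [CompleteSpace E] (h : IsFeedbackSol L q p u f) (k : E) {a : ℝ}
    (ha : 0 ≤ a) (h0 : ⟪p, f a⟫ = 0) {ε : ℝ} (hε : 0 < ε) :
    ∃ δ > 0, ∀ t, 0 ≤ t → |t - a| < δ →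
      |⟪k, f t⟫ - ⟪k, f a⟫ - ⟪k, L (f a)⟫ * (t - a)| ≤ ε * |t - a| := by
  have hcont : Continuous fun s =>
      |⟪k, L (f s)⟫ - ⟪k, L (f a)⟫| + |⟪p, f s⟫| * |⟪k, q⟫| := by
    have := h.continuous
    fun_prop
  have hev : ∀ᶠ s in 𝓝 a, |⟪k, L (f s)⟫ - ⟪k, L (f a)⟫| + |⟪p, f s⟫| * |⟪k, q⟫| < ε :=
    hcont.continuousAt.eventually (gt_mem_nhds (by simpa [h0] using hε))
  obtain ⟨δ, hδ, hball⟩ := Metric.eventually_nhds_iff.1 hev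
  refine ⟨δ, hδ, fun t ht hta => ?_⟩
  have hle := abs_integral_sub_affine_le (m := ⟪k, L (f a)⟫) (k := 0) (M := ε)
    (h.intervalIntegrable_inner k a t) fun s hs => ?_
  · rw [← h.inner_sub_eq_integral k ha ht] at hle
    simpa using hle
  · have hs' : dist s a < δ := by
      rw [Real.dist_eq]
      exact (Set.abs_sub_left_of_mem_uIcc hs).trans_lt hta
    refine le_trans ?_ (hball hs').le
    have hsplit : ⟪k, L (f s)⟫ + u s * ⟪p, f s⟫ * ⟪k, q⟫ - (⟪k, L (f a)⟫ + 0 * (s - a)) =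
        (⟪k, L (f s)⟫ - ⟪k, L (f a)⟫) + u s * (⟪p, f s⟫ * ⟪k, q⟫) := by ring
    rw [hsplit]
    refine (abs_add_le _ _).trans (add_le_add_right ?_ _)
    rw [abs_mul, abs_of_nonneg (h.mem_Icc s).1, ← abs_mul]
    exact mul_le_of_le_one_left (abs_nonneg _) (h.mem_Icc s).2

/-- If the pair `(L, p)` is observable, the output of a nowhere vanishing feedback solution has
isolated zeros. -/
lemma output_ne_zero_near [CompleteSpace E] (h : IsFeedbackSol L q p u f)
    (hobs : ∀ y, ⟪p, y⟫ = 0 → ⟪p, L y⟫ = 0 → ⟪p, L (L y)⟫ = 0 → y = 0) {a : ℝ} (ha : 0 ≤ a)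
    (hne : f a ≠ 0) :
    ∃ δ > 0, ∀ t, 0 ≤ t → t ≠ a → |t - a| < δ → ⟪p, f t⟫ ≠ 0 := by
  by_cases h0 : ⟪p, f a⟫ = 0
  swap
  · have hcont : Continuous fun t => ⟪p, f t⟫ := continuous_const.inner h.continuous
    obtain ⟨δ, hδ, hball⟩ := Metric.eventually_nhds_iff.1 (hcont.continuousAt.eventually_ne h0)
    exact ⟨δ, hδ, fun t _ _ hta => hball hta⟩
  by_cases h1 : ⟪p, L (f a)⟫ = 0
  swap
  · have hpos : 0 < |⟪p, L (f a)⟫| := abs_pos.2 h1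
    obtain ⟨δ, hδ, hle⟩ := h.abs_inner_sub_sub_le p ha h0 (half_pos hpos)
    refine ⟨δ, hδ, fun t ht hne' hta hzero => ?_⟩
    have hta' : 0 < |t - a| := abs_pos.2 (sub_ne_zero.2 hne')
    have := hle t ht hta
    rw [hzero, h0, sub_zero, zero_sub, abs_neg, abs_mul] at this
    nlinarith [mul_pos hpos hta']
  have h2 : ⟪p, L (L (f a))⟫ ≠ 0 := fun h2 => hne (hobs _ h0 h1 h2)
  set k := ⟪p, L (L (f a))⟫ with hk
  have hpos : 0 < |k| := abs_pos.2 h2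
  set ε := |k| / (4 * (1 + |⟪p, q⟫|)) with hεdef
  have hε : 0 < ε := by positivity
  have hεk : ε + ε * |⟪p, q⟫| = |k| / 4 := by
    rw [hεdef]
    field_simp
  obtain ⟨δ₁, hδ₁, hle₁⟩ := h.abs_inner_sub_sub_le (ContinuousLinearMap.adjoint L p) ha h0 hε
  obtain ⟨δ₂, hδ₂, hle₂⟩ := h.abs_inner_sub_sub_le p ha h0 hε
  simp only [ContinuousLinearMap.adjoint_inner_left, h1, sub_zero, ← hk] at hle₁
  simp only [h0, h1, sub_zero, zero_mul] at hle₂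
  refine ⟨min δ₁ δ₂, lt_min hδ₁ hδ₂, fun t ht hne' hta hzero => ?_⟩
  have hta' : 0 < |t - a| := abs_pos.2 (sub_ne_zero.2 hne')
  have hle := abs_integral_sub_affine_le (m := 0) (k := k) (M := |k| / 4 * |t - a|)
    (h.intervalIntegrable_inner p a t) fun s hs => ?_
  · rw [← h.inner_sub_eq_integral p ha ht, hzero, h0] at hle
    have habs : |(0 : ℝ) - 0 - (0 * (t - a) + k * (t - a) ^ 2 / 2)| = |k| * |t - a| ^ 2 / 2 := by
      rw [show (0 : ℝ) - 0 - (0 * (t - a) + k * (t - a) ^ 2 / 2) = -(k * (t - a) ^ 2 / 2) by ring,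
        abs_neg, abs_div, abs_mul, abs_pow, abs_two]
    rw [habs] at hle
    nlinarith [mul_pos hpos (pow_pos hta' 2)]
  · have hsa : |s - a| ≤ |t - a| := Set.abs_sub_left_of_mem_uIcc hs
    have hs0 : 0 ≤ s := le_trans (le_min ha ht) hs.1
    have hb₁ := hle₁ s hs0 (hsa.trans_lt (hta.trans_le (min_le_left _ _)))
    have hb₂ := hle₂ s hs0 (hsa.trans_lt (hta.trans_le (min_le_right _ _)))
    have hsplit : ⟪p, L (f s)⟫ + u s * ⟪p, f s⟫ * ⟪p, q⟫ - (0 + k * (s - a)) =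
        (⟪p, L (f s)⟫ - k * (s - a)) + u s * (⟪p, f s⟫ * ⟪p, q⟫) := by ring
    have hfb : |u s * (⟪p, f s⟫ * ⟪p, q⟫)| ≤ ε * |s - a| * |⟪p, q⟫| := by
      rw [abs_mul, abs_of_nonneg (h.mem_Icc s).1, abs_mul]
      exact (mul_le_of_le_one_left (by positivity) (h.mem_Icc s).2).trans
        (mul_le_mul_of_nonneg_right hb₂ (abs_nonneg _))
    rw [hsplit]
    calc _ ≤ ε * |s - a| + ε * |s - a| * |⟪p, q⟫| :=
          (abs_add_le _ _).trans (add_le_add hb₁ hfb)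
      _ = |k| / 4 * |s - a| := by rw [← hεk]; ring
      _ ≤ |k| / 4 * |t - a| := mul_le_mul_of_nonneg_left hsa (by positivity)

end IsFeedbackSol

end Feedback

section Decay

/-- A bounded nonnegative solution of `g' = a g + h` with `a ≠ 0` and `h → 0` tends to `0`. -/
lemma tendsto_zero_of_hasDerivAt_mul_add {a T M : ℝ} (ha : a ≠ 0) {g h : ℝ → ℝ}
    (hg : ∀ t > T, HasDerivAt g (a * g t + h t) t) (hg0 : ∀ t, 0 ≤ g t)
    (hM : ∀ t > T, g t ≤ M) (hh : Tendsto h atTop (𝓝 0)) : Tendsto g atTop (𝓝 0) := by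
  rw [Metric.tendsto_atTop]
  intro η hη
  have hapos : 0 < |a| := abs_pos.2 ha
  set ε := η * |a| / 2 with hε
  have hεpos : 0 < ε := by positivity
  have hεa : ε / |a| = η / 2 := by rw [hε]; field_simp
  obtain ⟨T₀, hT₀⟩ := Metric.tendsto_atTop.1 hh ε hεpos
  set T₁ := max (T + 1) T₀ with hT₁
  have hTT : T < T₁ := (lt_add_one T).trans_le (le_max_left _ _)
  have hh₁ : ∀ t ≥ T₁, |h t| < ε := fun t ht => by
    have := hT₀ t ((le_max_right _ _).trans ht)
    rwa [Real.dist_eq, sub_zero] at this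
  have hE : ∀ t, HasDerivAt (fun t => Real.exp (-(a * t))) (Real.exp (-(a * t)) * -a) t := fun t => by
    simpa using (((hasDerivAt_id t).const_mul a).neg).exp
  have hG : ∀ κ, ∀ t > T, HasDerivAt (fun t => (g t - κ) * Real.exp (-(a * t)))
      ((h t + a * κ) * Real.exp (-(a * t))) t := fun κ t ht =>
    (((hg t ht).sub_const κ).mul (hE t)).congr_deriv (by ring)
  have hGc : ∀ κ, ContinuousOn (fun t => (g t - κ) * Real.exp (-(a * t))) (Set.Ici T₁) :=
    fun κ t ht => (hG κ t (hTT.trans_le ht)).continuousAt.continuousWithinAt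
  suffices ∀ᶠ t in atTop, g t < η by
    obtain ⟨N, hN⟩ := eventually_atTop.1 this
    refine ⟨N, fun t ht => ?_⟩
    rw [Real.dist_eq, sub_zero, abs_of_nonneg (hg0 t)]
    exact hN t ht
  rcases ha.lt_or_gt with hneg | hpos
  · have hκ : ε / |a| * a = -ε := by
      rw [abs_of_neg hneg]
      field_simp
    have hanti : AntitoneOn (fun t => (g t - ε / |a|) * Real.exp (-(a * t))) (Set.Ici T₁) := by
      refine antitoneOn_of_hasDerivWithinAt_nonpos (convex_Ici _) (hGc _)
        (f' := fun t => (h t + a * (ε / |a|)) * Real.exp (-(a * t))) ?_ ?_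
      · intro t ht
        rw [interior_Ici] at ht
        exact (hG _ t (hTT.trans ht)).hasDerivWithinAt
      · intro t ht
        rw [interior_Ici] at ht
        have := (abs_lt.1 (hh₁ t (le_of_lt ht))).2
        exact mul_nonpos_of_nonpos_of_nonneg (by linarith) (Real.exp_pos _).le
    have hlim : Tendsto (fun t => (g T₁ - ε / |a|) * Real.exp (-(a * T₁)) * Real.exp (a * t))
        atTop (𝓝 0) := by
      have h1 : Tendsto (fun t : ℝ => a * t) atTop atBot := tendsto_id.const_mul_atTop_of_neg hneg
      simpa using (Real.tendsto_exp_atBot.comp h1).const_mul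
        ((g T₁ - ε / |a|) * Real.exp (-(a * T₁)))
    filter_upwards [hlim.eventually (gt_mem_nhds (half_pos hη)), eventually_ge_atTop T₁]
      with t ht htT
    have h1 : (g t - ε / |a|) * Real.exp (-(a * t)) ≤
        (g T₁ - ε / |a|) * Real.exp (-(a * T₁)) := hanti Set.self_mem_Ici htT htT
    have h2 := mul_le_mul_of_nonneg_right h1 (Real.exp_pos (a * t)).le
    rw [mul_assoc, ← Real.exp_add, neg_add_cancel, Real.exp_zero, mul_one] at h2
    linarith
  · have hκ : ε / |a| * a = ε := by
      rw [abs_of_pos hpos]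
      field_simp
    have hmono : MonotoneOn (fun t => (g t - ε / |a|) * Real.exp (-(a * t))) (Set.Ici T₁) := by
      refine monotoneOn_of_hasDerivWithinAt_nonneg (convex_Ici _) (hGc _)
        (f' := fun t => (h t + a * (ε / |a|)) * Real.exp (-(a * t))) ?_ ?_
      · intro t ht
        rw [interior_Ici] at ht
        exact (hG _ t (hTT.trans ht)).hasDerivWithinAt
      · intro t ht
        rw [interior_Ici] at ht
        have := (abs_lt.1 (hh₁ t (le_of_lt ht))).1
        exact mul_nonneg (by linarith) (Real.exp_pos _).le
    have hlim : Tendsto (fun t => (M - ε / |a|) * Real.exp (-(a * t))) atTop (𝓝 0) := by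
      have h1 : Tendsto (fun t : ℝ => -(a * t)) atTop atBot :=
        tendsto_neg_atTop_atBot.comp (tendsto_id.const_mul_atTop hpos)
      simpa using (Real.tendsto_exp_atBot.comp h1).const_mul (M - ε / |a|)
    filter_upwards [eventually_ge_atTop T₁] with t ht
    have hle : (g t - ε / |a|) * Real.exp (-(a * t)) ≤ 0 := by
      refine ge_of_tendsto hlim ?_
      filter_upwards [eventually_ge_atTop t] with s hs
      refine (hmono (a := t) (b := s) ht (le_trans ht hs) hs).trans ?_
      exact mul_le_mul_of_nonneg_right
        (sub_le_sub_right (hM s (hTT.trans_le (le_trans ht hs))) _) (Real.exp_pos _).le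
    have := nonpos_of_mul_nonpos_left hle (Real.exp_pos _)
    linarith

/-- A bounded solution of the complex scalar equation `z' = μ z + r` with `re μ ≠ 0` and `r → 0`
tends to `0`. -/
lemma tendsto_zero_of_hasDerivAt_complex {μ : ℂ} (hμ : μ.re ≠ 0) {T M : ℝ} {z r : ℝ → ℂ}
    (hz : ∀ t > T, HasDerivAt z (μ * z t + r t) t) (hM : ∀ t, ‖z t‖ ≤ M)
    (hr : Tendsto r atTop (𝓝 0)) : Tendsto z atTop (𝓝 0) := by
  have hinner : Tendsto (fun t => 2 * inner ℝ (z t) (r t)) atTop (𝓝 0) := by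
    refine squeeze_zero_norm (a := fun t => 2 * (M * ‖r t‖)) (fun t => ?_) ?_
    · rw [norm_mul, Real.norm_ofNat]
      refine mul_le_mul_of_nonneg_left ((norm_inner_le_norm _ _).trans ?_) zero_le_two
      exact mul_le_mul_of_nonneg_right (hM t) (norm_nonneg _)
    · simpa using (hr.norm.const_mul M).const_mul 2
  have hsq : Tendsto (fun t => ‖z t‖ ^ 2) atTop (𝓝 0) := by
    refine tendsto_zero_of_hasDerivAt_mul_add (a := 2 * μ.re) (M := M ^ 2) (T := T)
      (mul_ne_zero two_ne_zero hμ) (fun t ht => (hz t ht).norm_sq.congr_deriv ?_)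
      (fun t => by positivity)
      (fun t _ => pow_le_pow_left₀ (norm_nonneg _) (hM t) 2) hinner
    have hself : inner ℝ (z t) (μ * z t) = μ.re * ‖z t‖ ^ 2 := by
      rw [Complex.inner, ← Complex.normSq_eq_norm_sq, mul_assoc, Complex.mul_conj,
        Complex.re_mul_ofReal]
    rw [inner_add_right, hself]
    ring
  have := hsq.sqrt
  simp only [Real.sqrt_zero, Real.sqrt_sq (norm_nonneg _)] at this
  exact tendsto_zero_iff_norm_tendsto_zero.2 this

/-- The real-linear functional `y ↦ ∑ i, φ i * y i` with complex coefficients. -/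
def complexFunctional (φ : Fin 3 → ℂ) : Vec3 →L[ℝ] ℂ :=
  ∑ i, φ i • (Complex.ofRealCLM.comp (EuclideanSpace.proj i : Vec3 →L[ℝ] ℝ))

lemma complexFunctional_apply (φ : Fin 3 → ℂ) (y : Vec3) :
    complexFunctional φ y = φ ⬝ᵥ fun i => (y i : ℂ) := by
  simp [complexFunctional, dotProduct]

lemma complexFunctional_mulE (φ : Fin 3 → ℂ) (B : Matrix (Fin 3) (Fin 3) ℝ) (y : Vec3) :
    complexFunctional φ (mulE B y) = complexFunctional (φ ᵥ* B.map fun r => (r : ℂ)) y := by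
  rw [complexFunctional_apply, complexFunctional_apply, ← dotProduct_mulVec]
  congr 1
  ext i
  simp [mulE, Matrix.mulVec, dotProduct, Matrix.toLpLin_apply]

/-- `mulE B` as a continuous linear map. -/
def mulECLM (B : Matrix (Fin 3) (Fin 3) ℝ) : Vec3 →L[ℝ] Vec3 :=
  LinearMap.toContinuousLinearMap (Matrix.toEuclideanLin B)

lemma mulECLM_apply (B : Matrix (Fin 3) (Fin 3) ℝ) (y : Vec3) : mulECLM B y = mulE B y := rfl

/-- A bounded solution of `y' = B y + r` with `r → 0` tends to `0` as soon as `B` has no eigenvalue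
on the imaginary axis. -/
lemma tendsto_zero_of_hasDerivAt_mulE {B : Matrix (Fin 3) (Fin 3) ℝ}
    (hB : ∀ μ : ℂ, (B.map fun r => (r : ℂ)).charpoly.IsRoot μ → μ.re ≠ 0) {T M : ℝ}
    {y r : ℝ → Vec3} (hy : ∀ t > T, HasDerivAt y (mulE B (y t) + r t) t) (hM : ∀ t, ‖y t‖ ≤ M)
    (hr : Tendsto r atTop (𝓝 0)) : Tendsto y atTop (𝓝 0) := by
  set Bc := B.map fun r => (r : ℂ) with hBc
  have key : ∀ s : Multiset ℂ, (∀ μ ∈ s, μ.re ≠ 0) → ∀ φ : Fin 3 → ℂ,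
      φ ᵥ* Polynomial.aeval Bc (s.map fun μ => Polynomial.X - Polynomial.C μ).prod = 0 →
      Tendsto (fun t => complexFunctional φ (y t)) atTop (𝓝 0) := by
    intro s
    induction s using Multiset.induction_on with
    | empty =>
      intro _ φ hφ
      have : φ = 0 := by simpa using hφ
      simp [this, complexFunctional_apply]
    | cons μ s ih =>
      intro hs φ hφ
      have hφ' : φ ᵥ* (Bc - algebraMap ℂ _ μ) = φ ᵥ* Bc - μ • φ := by
        rw [Matrix.vecMul_sub, Algebra.algebraMap_eq_smul_one, Matrix.vecMul_smul,
          Matrix.vecMul_one]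
      have hlim := ih (fun ν hν => hs ν (Multiset.mem_cons_of_mem hν)) (φ ᵥ* Bc - μ • φ) (by
        rw [← hφ', Matrix.vecMul_vecMul]
        simpa using hφ)
      have hrφ : Tendsto (fun t => complexFunctional φ (r t)) atTop (𝓝 0) := by
        simpa [Function.comp_def] using ((complexFunctional φ).continuous.tendsto 0).comp hr
      refine tendsto_zero_of_hasDerivAt_complex (hs μ (Multiset.mem_cons_self μ s))
        (M := ‖complexFunctional φ‖ * M) (T := T)
        (r := fun t => complexFunctional (φ ᵥ* Bc - μ • φ) (y t) + complexFunctional φ (r t))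
        (fun t ht => ?_) (fun t => (complexFunctional φ).le_opNorm_of_le (hM t))
        (by simpa using hlim.add hrφ)
      refine ((complexFunctional φ).hasFDerivAt.comp_hasDerivAt t (hy t ht)).congr_deriv ?_
      rw [map_add, complexFunctional_mulE]
      simp only [complexFunctional_apply, sub_dotProduct, smul_dotProduct, smul_eq_mul, ← hBc]
      ring
  have hsplit := (IsAlgClosed.splits Bc.charpoly).eq_prod_roots
  rw [(Matrix.charpoly_monic Bc).leadingCoeff, Polynomial.C_1, one_mul] at hsplit
  have hcoord : ∀ i, Tendsto (fun t => y t i) atTop (𝓝 0) := fun i => by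
    have h1 := key Bc.charpoly.roots
      (fun μ hμ => hB μ ((Polynomial.mem_roots (Matrix.charpoly_monic Bc).ne_zero).1 hμ))
      (Pi.single i 1) (by rw [← hsplit, Matrix.aeval_self_charpoly, Matrix.vecMul_zero])
    have h2 := (Complex.continuous_re.tendsto 0).comp h1
    simpa [complexFunctional_apply, Function.comp_def] using h2
  have hpi : Tendsto (fun t => WithLp.ofLp (y t)) atTop (𝓝 (0 : Fin 3 → ℝ)) :=
    tendsto_pi_nhds.2 hcoord
  exact ((PiLp.continuous_toLp 2 fun _ : Fin 3 => ℝ).tendsto 0).comp hpi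

/-- If `B` and `B + q pᵀ` have determinants of the same sign (encoded through `k` with
`⟪k, B y⟫ = ⟪p, y⟫` and `1 + ⟪k, q⟫ > 0`) and `B` has no imaginary eigenvalue, then the output
of a feedback solution which is bounded and bounded away from `0` takes positive values at
arbitrarily large times. -/
lemma IsFeedbackSol.exists_output_pos {B : Matrix (Fin 3) (Fin 3) ℝ} {q p k : Vec3} {u : ℝ → ℝ}
    {f : ℝ → Vec3} (h : IsFeedbackSol (mulECLM B) q p u f)
    (hB : ∀ μ : ℂ, (B.map fun r => (r : ℂ)).charpoly.IsRoot μ → μ.re ≠ 0)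
    (hk : ∀ y, ⟪k, mulE B y⟫ = ⟪p, y⟫) (hkq : 0 < 1 + ⟪k, q⟫) {m M : ℝ} (hm : 0 < m)
    (hmf : ∀ t ≥ 0, m ≤ ‖f t‖) (hfM : ∀ t ≥ 0, ‖f t‖ ≤ M) {T : ℝ} (hT : 0 ≤ T) :
    ∃ t > T, 0 < ⟪p, f t⟫ := by
  by_contra! hneg
  have hnegT : ∀ t ≥ T, ⟪p, f t⟫ ≤ 0 := fun t ht => by
    have hc : Continuous fun t => ⟪p, f t⟫ := continuous_const.inner h.continuous
    refine le_on_closure (s := Set.Ioi T) (fun s hs => hneg s hs) hc.continuousOn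
      continuousOn_const ?_
    rwa [closure_Ioi]
  set w : ℝ → ℝ := fun s => u s * ⟪p, f s⟫ with hw
  have hwint : ∀ a b, IntervalIntegrable w volume a b := h.intervalIntegrable_feedback
  set W : ℝ → ℝ := fun t => ∫ s in T..(max t T), w s with hW
  have hwneg : ∀ s ≥ T, w s ≤ 0 := fun s hs =>
    mul_nonpos_of_nonneg_of_nonpos (h.mem_Icc s).1 (hnegT s hs)
  have hprim : ∀ {a b : ℝ}, T ≤ a → a ≤ b → ∫ s in a..b, w s ≤ 0 := fun ha hab => by
    have h1 := intervalIntegral.integral_nonneg (μ := volume) (f := fun s => -w s) hab fun s hs =>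
      neg_nonneg.2 (hwneg s (ha.trans hs.1))
    rw [intervalIntegral.integral_neg] at h1
    linarith
  have hanti : Antitone W := fun a b hab => by
    have hle : max a T ≤ max b T := max_le_max_right T hab
    have h1 : W b - W a = ∫ s in (max a T)..(max b T), w s :=
      intervalIntegral.integral_interval_sub_left (hwint _ _) (hwint _ _)
    have h2 := hprim (le_max_right a T) hle
    linarith
  set δ := min 1 (1 + ⟪k, q⟫) with hδ
  have hδpos : 0 < δ := lt_min one_pos hkq
  have hbdd : BddBelow (Set.range W) := by
    refine ⟨-(2 * (‖k‖ * M)) / δ, ?_⟩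
    rintro _ ⟨t, rfl⟩
    have hle : T ≤ max t T := le_max_right _ _
    have h1 := h.inner_sub_eq_integral k hT (hT.trans hle)
    have h2 : ∫ r in T..(max t T), (⟪k, mulECLM B (f r)⟫ + u r * ⟪p, f r⟫ * ⟪k, q⟫) ≤
        ∫ r in T..(max t T), δ * w r := by
      refine intervalIntegral.integral_mono_on hle (h.intervalIntegrable_inner k _ _)
        ((hwint _ _).const_mul δ) fun r hr => ?_
      rw [mulECLM_apply, hk]
      have hu := h.mem_Icc r
      have hp := hnegT r hr.1
      have h3 : δ * u r ≤ 1 + u r * ⟪k, q⟫ := by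
        rcases le_total 1 (1 + ⟪k, q⟫) with hc | hc
        · rw [hδ, min_eq_left hc]
          nlinarith [hu.1, hu.2]
        · rw [hδ, min_eq_right hc]
          nlinarith [hu.1, hu.2]
      simp only [hw]
      nlinarith [mul_nonneg (sub_nonneg.2 h3) (neg_nonneg.2 hp)]
    rw [intervalIntegral.integral_const_mul, ← h1] at h2
    have h3 : ∀ s ≥ 0, |⟪k, f s⟫| ≤ ‖k‖ * M := fun s hs =>
      (abs_real_inner_le_norm _ _).trans (mul_le_mul_of_nonneg_left (hfM s hs) (norm_nonneg _))
    rw [div_le_iff₀ hδpos]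
    have h4 := (abs_le.1 (h3 _ (hT.trans hle))).1
    have h5 := (abs_le.1 (h3 T hT)).2
    have h6 : W t * δ = δ * ∫ s in T..(max t T), w s := mul_comm _ _
    linarith
  obtain ⟨W₀, hW₀⟩ : ∃ W₀, Tendsto W atTop (𝓝 W₀) := ⟨_, tendsto_atTop_ciInf hanti hbdd⟩
  set y : ℝ → Vec3 := fun t => f (max t T) - (W t - W₀) • q with hy
  have hWzero : Tendsto (fun t => W t - W₀) atTop (𝓝 0) := by simpa using hW₀.sub_const W₀
  have hBcont : Continuous fun s => mulECLM B (f s) := (mulECLM B).continuous.comp h.continuous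
  have hyeq : ∀ t > T, y t = (f T + W₀ • q) + ∫ s in T..t, mulECLM B (f s) := fun t ht => by
    have h1 := h.sub_eq_integral hT (hT.trans (le_of_lt ht))
    rw [intervalIntegral.integral_add (hBcont.intervalIntegrable _ _)
      ((hwint T t).smul_continuousOn continuousOn_const), intervalIntegral.integral_smul_const,
      sub_eq_iff_eq_add] at h1
    simp only [hy, hW, max_eq_left (le_of_lt ht), h1, sub_smul]
    abel
  have hyd : ∀ t > T, HasDerivAt y (mulE B (y t) + (W t - W₀) • mulE B q) t := fun t ht => by
    have h1 : HasDerivAt (fun t => (f T + W₀ • q) + ∫ s in T..t, mulECLM B (f s))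
        (mulECLM B (f t)) t :=
      (intervalIntegral.integral_hasDerivAt_right (hBcont.intervalIntegrable _ _)
        hBcont.stronglyMeasurable.stronglyMeasurableAtFilter hBcont.continuousAt).const_add _
    refine (h1.congr_of_eventuallyEq ?_).congr_deriv ?_
    · filter_upwards [lt_mem_nhds ht] with s hs using hyeq s hs
    · simp only [hy, max_eq_left (le_of_lt ht), ← mulECLM_apply, map_sub, map_smul,
        sub_add_cancel]
  have hWM : ∃ K, ∀ t, |W t - W₀| ≤ K := by
    obtain ⟨K, hK⟩ := hbdd
    refine ⟨|K| + |W₀|, fun t => (abs_sub _ _).trans (add_le_add_left ?_ _)⟩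
    have h1 : W t ≤ 0 := hprim le_rfl (le_max_right _ _)
    rw [abs_of_nonpos h1]
    have h2 : K ≤ W t := hK ⟨t, rfl⟩
    linarith [neg_abs_le K]
  obtain ⟨K, hK⟩ := hWM
  have hylim : Tendsto y atTop (𝓝 0) := by
    refine tendsto_zero_of_hasDerivAt_mulE hB (M := M + K * ‖q‖) hyd (fun t => ?_)
      (by simpa using hWzero.smul_const (mulE B q))
    refine (norm_sub_le _ _).trans (add_le_add (hfM _ (hT.trans (le_max_right _ _))) ?_)
    rw [norm_smul, Real.norm_eq_abs]
    exact mul_le_mul_of_nonneg_right (hK t) (norm_nonneg _)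
  have hflim : Tendsto (fun t => f (max t T)) atTop (𝓝 0) := by
    simpa [hy] using hylim.add (hWzero.smul_const q)
  have hmle : m ≤ 0 := by
    have h1 := hflim.norm
    rw [norm_zero] at h1
    exact ge_of_tendsto h1 (Eventually.of_forall fun t => hmf _ (hT.trans (le_max_right _ _)))
  exact absurd hm hmle.not_gt

end Decay

section Data

/-- A real `3 × 3` Hurwitz matrix has negative determinant. -/
lemma IsHurwitz.det_neg {A : Matrix (Fin 3) (Fin 3) ℝ} (hA : IsHurwitz A) : A.det < 0 := by
  have hroot : ∀ r : ℝ, A.charpoly.eval r = 0 → r < 0 := fun r hr => by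
    refine hA (r : ℂ) ?_
    have hmap : (A.map fun r => (r : ℂ)).charpoly = A.charpoly.map Complex.ofRealHom :=
      Matrix.charpoly_map A Complex.ofRealHom
    rw [hmap, Polynomial.IsRoot, ← Complex.ofRealHom_eq_coe, Polynomial.eval_map_apply, hr,
      map_zero]
  have hpos : 0 < A.charpoly.eval 0 := by
    by_contra! hle
    have hdeg : 0 < A.charpoly.degree := by
      rw [Matrix.charpoly_degree_eq_dim]
      simp
    have htend := A.charpoly.tendsto_atTop_of_leadingCoeff_nonneg hdeg
      (by rw [(Matrix.charpoly_monic A).leadingCoeff]; exact zero_le_one)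
    obtain ⟨N, hN, hN0⟩ := ((htend.eventually_gt_atTop 0).and (eventually_ge_atTop 0)).exists
    obtain ⟨r, hr, hr0⟩ := intermediate_value_Icc hN0 A.charpoly.continuous.continuousOn
      ⟨hle, hN.le⟩
    exact absurd (hroot r hr0) (not_lt.2 hr.1)
  rw [Matrix.det_eq_sign_charpoly_coeff, Polynomial.coeff_zero_eq_eval_zero]
  norm_num
  exact hpos

lemma vec3_inner_eq (x y : Vec3) : ⟪x, y⟫ = x.ofLp ⬝ᵥ y.ofLp := by
  rw [EuclideanSpace.inner_eq_star_dotProduct, star_trivial, dotProduct_comm]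

lemma exists_inner_mulE_eq {B : Matrix (Fin 3) (Fin 3) ℝ} {q p : Vec3}
    (h : 0 < B.det * (B + bcMat q p).det) :
    ∃ k : Vec3, (∀ y, ⟪k, mulE B y⟫ = ⟪p, y⟫) ∧ 0 < 1 + ⟪k, q⟫ := by
  have hdet : B.det ≠ 0 := fun h0 => by simp [h0] at h
  have hunit : IsUnit B.det := isUnit_iff_ne_zero.2 hdet
  refine ⟨WithLp.toLp 2 (p.ofLp ᵥ* B⁻¹), fun y => ?_, ?_⟩
  · rw [vec3_inner_eq, vec3_inner_eq, mulE, Matrix.toLpLin_apply, dotProduct_mulVec,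
      Matrix.vecMul_vecMul, Matrix.nonsing_inv_mul _ hunit, Matrix.vecMul_one]
  · have hrank : (B + bcMat q p).det = B.det * (1 + p.ofLp ᵥ* B⁻¹ ⬝ᵥ q.ofLp) := by
      rw [bcMat, Matrix.vecMulVec_eq Unit, Matrix.det_add_replicateCol_mul_replicateRow hunit]
      congr 1
      rw [Matrix.det_unique, ← Matrix.replicateRow_vecMul]
      simp [Matrix.add_apply, Matrix.mul_apply, dotProduct]
    rw [hrank, ← mul_assoc] at h
    rw [vec3_inner_eq]
    exact pos_of_mul_pos_right h (mul_self_nonneg _)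

lemma neg_transpose_add_bcMat (A : Matrix (Fin 3) (Fin 3) ℝ) (b c : Vec3) :
    -Aᵀ + bcMat (-c) b = -(A + bcMat b c)ᵀ := by
  ext i j
  simp [bcMat, Matrix.vecMulVec_apply]
  ring

/-- The eigenvalues of `-Aᵀ` are the opposites of those of `A`. -/
lemma IsHurwitz.re_pos_of_neg_transpose {A : Matrix (Fin 3) (Fin 3) ℝ} (hA : IsHurwitz A) {μ : ℂ}
    (hμ : ((-Aᵀ).map fun r => (r : ℂ)).charpoly.IsRoot μ) : 0 < μ.re := by
  have hroot : (A.map fun r => (r : ℂ)).charpoly.IsRoot (-μ) := by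
    rw [Polynomial.IsRoot, Matrix.eval_charpoly] at hμ ⊢
    have hmat : Matrix.scalar (Fin 3) (-μ) - A.map (fun r => (r : ℂ)) =
        -(Matrix.scalar (Fin 3) μ - (-Aᵀ).map fun r => (r : ℂ))ᵀ := by
      ext i j
      by_cases hij : i = j
      · subst hij
        simp
        ring
      · simp [Matrix.diagonal_apply_ne, hij]
    rw [hmat, Matrix.det_neg, Matrix.det_transpose, hμ, mul_zero]
  have := hA _ hroot
  rw [Complex.neg_re] at this
  linarith

/-- Three independent vectors of `ℝ³` have trivial orthogonal complement. -/
lemma eq_zero_of_inner_eq_zero {w : Fin 3 → Vec3} (hw : LinearIndependent ℝ w) {y : Vec3}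
    (hy : ∀ i, ⟪w i, y⟫ = 0) : y = 0 := by
  have hspan : Submodule.span ℝ (Set.range w) = ⊤ :=
    hw.span_eq_top_of_card_eq_finrank (by simp)
  have hall : ∀ z ∈ Submodule.span ℝ (Set.range w), ⟪z, y⟫ = 0 := fun z hz => by
    induction hz using Submodule.span_induction with
    | mem z hz => obtain ⟨i, rfl⟩ := hz; exact hy i
    | zero => exact inner_zero_left y
    | add z₁ z₂ _ _ h₁ h₂ => rw [inner_add_left, h₁, h₂, add_zero]
    | smul a z _ h => rw [inner_smul_left, h, mul_zero]
  exact inner_self_eq_zero.1 (hall y (hspan ▸ Submodule.mem_top))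

lemma inner_mulE_transpose (A : Matrix (Fin 3) (Fin 3) ℝ) (x y : Vec3) :
    ⟪mulE Aᵀ x, y⟫ = ⟪x, mulE A y⟫ := by
  rw [vec3_inner_eq, vec3_inner_eq, mulE, mulE, Matrix.toLpLin_apply, Matrix.toLpLin_apply,
    dotProduct_mulVec, Matrix.mulVec_transpose]

lemma eq_zero_of_inner_krylov {A : Matrix (Fin 3) (Fin 3) ℝ} {p : Vec3}
    (hp : LinearIndependent ℝ ![p, mulE Aᵀ p, mulE Aᵀ (mulE Aᵀ p)]) {y : Vec3} (h0 : ⟪p, y⟫ = 0)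
    (h1 : ⟪p, mulE A y⟫ = 0) (h2 : ⟪p, mulE A (mulE A y)⟫ = 0) : y = 0 := by
  refine eq_zero_of_inner_eq_zero hp fun i => ?_
  fin_cases i
  · exact h0
  · exact (inner_mulE_transpose A p y).trans h1
  · exact (inner_mulE_transpose A _ y).trans ((inner_mulE_transpose A p _).trans h2)

lemma mulE_neg_matrix (A : Matrix (Fin 3) (Fin 3) ℝ) (y : Vec3) : mulE (-A) y = -mulE A y := by
  simp [mulE]

namespace IsBNorm

variable {v : Vec3 → ℝ}

lemma nonneg (hv : IsBNorm v) (y : Vec3) : 0 ≤ v y := by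
  have h1 := hv.2.2 y ((-1 : ℝ) • y)
  rw [hv.2.1, neg_smul, one_smul, add_neg_cancel, (hv.1 0).2 rfl, abs_neg, abs_one] at h1
  linarith

lemma pos (hv : IsBNorm v) {y : Vec3} (hy : y ≠ 0) : 0 < v y :=
  (hv.nonneg y).lt_of_ne fun h => hy ((hv.1 y).1 h.symm)

lemma exists_le_mul_norm (hv : IsBNorm v) : ∃ C > 0, ∀ y, v y ≤ C * ‖y‖ := by
  set e : Fin 3 → Vec3 := fun i => EuclideanSpace.single i 1 with he
  refine ⟨v (e 0) + v (e 1) + v (e 2) + 1, ?_, fun y => ?_⟩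
  · linarith [hv.nonneg (e 0), hv.nonneg (e 1), hv.nonneg (e 2)]
  · have hsum : y = (y 0 • e 0 + y 1 • e 1) + y 2 • e 2 := by
      ext i
      fin_cases i <;> simp [he]
    have h1 : v y ≤ |y 0| * v (e 0) + |y 1| * v (e 1) + |y 2| * v (e 2) := by
      conv_lhs => rw [hsum]
      refine (hv.2.2 _ _).trans (add_le_add ((hv.2.2 _ _).trans_eq ?_) (hv.2.1 _ _).le)
      rw [hv.2.1, hv.2.1]
    have h2 : ∀ i, |y i| * v (e i) ≤ ‖y‖ * v (e i) := fun i =>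
      mul_le_mul_of_nonneg_right (PiLp.norm_apply_le y i) (hv.nonneg _)
    nlinarith [h2 0, h2 1, h2 2, norm_nonneg y]

lemma continuous (hv : IsBNorm v) : Continuous v := by
  obtain ⟨C, hC, hle⟩ := hv.exists_le_mul_norm
  have h1 : ∀ x y, v x - v y ≤ C * dist x y := fun x y => by
    have h2 := hv.2.2 (x - y) y
    rw [sub_add_cancel] at h2
    rw [dist_eq_norm]
    linarith [hle (x - y)]
  have h3 : ∀ x y, v y - v x ≤ C * dist x y := fun x y => dist_comm x y ▸ h1 y x
  refine (LipschitzWith.of_dist_le_mul (K := C.toNNReal) fun x y => ?_).continuous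
  rw [Real.coe_toNNReal _ hC.le, Real.dist_eq]
  exact abs_le.2 ⟨by linarith [h3 x y], h1 x y⟩

lemma exists_mul_norm_le (hv : IsBNorm v) : ∃ c > 0, ∀ y, c * ‖y‖ ≤ v y := by
  obtain ⟨z, hz, hmin⟩ := (isCompact_sphere (0 : Vec3) 1).exists_isMinOn
    (NormedSpace.sphere_nonempty.2 zero_le_one) hv.continuous.continuousOn
  have hz0 : z ≠ 0 := ne_zero_of_mem_unit_sphere ⟨z, hz⟩
  refine ⟨v z, hv.pos hz0, fun y => ?_⟩
  by_cases hy : y = 0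
  · simp [hy, (hv.1 0).2 rfl]
  · have hyn : 0 < ‖y‖ := norm_pos_iff.2 hy
    have hmem : ‖y‖⁻¹ • y ∈ Metric.sphere (0 : Vec3) 1 := by
      simp [norm_smul, hyn.ne']
    have hle : v z ≤ v (‖y‖⁻¹ • y) := hmin hmem
    rw [hv.2.1, abs_of_pos (inv_pos.2 hyn), inv_mul_eq_div, le_div_iff₀ hyn] at hle
    exact hle

/-- Subgradients of `v` along a level set of positive height, together with their base points, are
bounded and bounded away from zero. -/
lemma exists_bounds (hv : IsBNorm v) {V : ℝ} (hV : 0 < V) :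
    ∃ m > 0, ∃ M, ∀ x l, v x = V → l ∈ subdiff3 v x →
      (m ≤ ‖x‖ ∧ ‖x‖ ≤ M) ∧ m ≤ ‖l‖ ∧ ‖l‖ ≤ M := by
  obtain ⟨C, hC, hle⟩ := hv.exists_le_mul_norm
  obtain ⟨κ, hκ, hge⟩ := hv.exists_mul_norm_le
  refine ⟨min (V / C) κ, lt_min (by positivity) hκ, max (V / κ) C, fun x l hx hl => ?_⟩
  have hx1 : V ≤ C * ‖x‖ := hx ▸ hle x
  have hx2 : κ * ‖x‖ ≤ V := hx ▸ hge x
  have hxpos : 0 < ‖x‖ := pos_of_mul_pos_right (hV.trans_le hx1) hC.le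
  have hl1 : ‖l‖ * ‖l‖ ≤ C * ‖l‖ := by
    rw [← real_inner_self_eq_norm_mul_norm]
    exact (hl.2 l).trans (hle l)
  have hl2 : κ * ‖x‖ ≤ ‖l‖ * ‖x‖ := (hge x).trans (hl.1 ▸ real_inner_le_norm l x)
  have hl3 : κ ≤ ‖l‖ := le_of_mul_le_mul_right hl2 hxpos
  refine ⟨⟨min_le_of_left_le ?_, le_max_of_le_left ?_⟩, min_le_of_right_le hl3,
    le_max_of_le_right (le_of_mul_le_mul_right hl1 (hκ.trans_le hl3))⟩
  · rw [div_le_iff₀ hC]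
    linarith
  · rw [le_div_iff₀ hκ]
    linarith

end IsBNorm

lemma IsBSolWith.isFeedbackSol {A : Matrix (Fin 3) (Fin 3) ℝ} {b c : Vec3} {u : ℝ → ℝ}
    {x : ℝ → Vec3} (hx : IsBSolWith A b c u x) :
    IsFeedbackSol (mulECLM A) b c u fun t => x (max t 0) :=
  .of_continuousOn hx.1 hx.2.1 hx.2.2.1 hx.2.2.2

lemma IsBAdjWith.isFeedbackSol {A : Matrix (Fin 3) (Fin 3) ℝ} {b c : Vec3} {u : ℝ → ℝ}
    {l : ℝ → Vec3} (hl : IsBAdjWith A b c u l) (hu : Measurable u)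
    (hmem : ∀ t, u t ∈ Set.Icc (0 : ℝ) 1) :
    IsFeedbackSol (mulECLM (-Aᵀ)) (-c) b u fun t => l (max t 0) := by
  refine .of_continuousOn hu hmem hl.1 fun t ht => ?_
  rw [hl.2 t ht, sub_eq_add_neg, ← intervalIntegral.integral_neg]
  congr 2
  ext1 s
  rw [mulECLM_apply, mulE_neg_matrix, smul_neg, neg_add]

end Data

theorem stmt16 (A : Matrix (Fin 3) (Fin 3) ℝ) (b c : Vec3)
    (hdata : IsBarabanovData A b c)
    (v : Vec3 → ℝ) (hv : IsBBarabanov A b c v)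
    (u : ℝ → ℝ) (x l : ℝ → Vec3)
    (hx : IsBSolWith A b c u x) (hxe : ∀ t ≥ (0:ℝ), v (x t) = v (x 0)) (hx0 : x 0 ≠ 0)
    (hl : IsBAdjWith A b c u l) (hsub : ∀ t ≥ (0:ℝ), l t ∈ subdiff3 v (x t)) :
    (∀ t ≥ (0:ℝ), ⟪b, l t⟫ * ⟪c, x t⟫ = 0 →
      ∃ ε > (0:ℝ), ∀ s, 0 ≤ s → s ≠ t → |s - t| < ε → ⟪b, l s⟫ * ⟪c, x s⟫ ≠ 0) ∧
    ∀ T ≥ (0:ℝ), (∃ t₁ > T, 0 < ⟪b, l t₁⟫) ∧ (∃ t₂ > T, ⟪b, l t₂⟫ < 0) ∧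
      (∃ t₃ > T, 0 < ⟪c, x t₃⟫) ∧ (∃ t₄ > T, ⟪c, x t₄⟫ < 0) := by
  obtain ⟨hA, hAbc, hb, hc, -⟩ := hdata
  obtain ⟨m, hm, M, hbd⟩ := hv.1.exists_bounds (hv.1.pos hx0)
  have hbd' : ∀ t ≥ (0 : ℝ), (m ≤ ‖x t‖ ∧ ‖x t‖ ≤ M) ∧ m ≤ ‖l t‖ ∧ ‖l t‖ ≤ M :=
    fun t ht => hbd _ _ (hxe t ht) (hsub t ht)
  have hX := hx.isFeedbackSol
  have hL := hl.isFeedbackSol hx.1 hx.2.1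
  constructor
  · intro t ht _
    have hxt : x (max t 0) ≠ 0 :=
      norm_pos_iff.1 (hm.trans_le (hbd' _ (le_max_right t 0)).1.1)
    have hlt : l (max t 0) ≠ 0 :=
      norm_pos_iff.1 (hm.trans_le (hbd' _ (le_max_right t 0)).2.1)
    obtain ⟨δ₁, hδ₁, h₁⟩ := hX.output_ne_zero_near
      (fun y h0 h1 h2 => eq_zero_of_inner_krylov hc h0 h1 h2) ht hxt
    obtain ⟨δ₂, hδ₂, h₂⟩ := hL.output_ne_zero_near (fun y h0 h1 h2 => by
      simp only [mulECLM_apply, mulE_neg_matrix] at h1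
      have h2' : ⟪b, mulE Aᵀ (mulE Aᵀ y)⟫ = 0 := by
        simp only [mulECLM_apply, mulE_neg_matrix] at h2
        simpa [mulE] using h2
      exact eq_zero_of_inner_krylov (A := Aᵀ) (by rwa [Matrix.transpose_transpose]) h0
        (by simpa using h1) h2') ht hlt
    refine ⟨min δ₁ δ₂, lt_min hδ₁ hδ₂, fun s hs hst hsd => mul_ne_zero ?_ ?_⟩
    · simpa only [max_eq_left hs] using h₂ s hs hst (hsd.trans_le (min_le_right _ _))
    · simpa only [max_eq_left hs] using h₁ s hs hst (hsd.trans_le (min_le_left _ _))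
  · intro T hT
    obtain ⟨k, hk, hkb⟩ := exists_inner_mulE_eq (mul_pos_of_neg_of_neg hA.det_neg hAbc.det_neg)
    obtain ⟨k', hk', hkc⟩ := exists_inner_mulE_eq (B := -Aᵀ) (q := -c) (p := b) (by
      rw [neg_transpose_add_bcMat, Matrix.det_neg, Matrix.det_neg, Matrix.det_transpose,
        Matrix.det_transpose]
      norm_num
      exact mul_pos_of_neg_of_neg hA.det_neg hAbc.det_neg)
    have hspec : ∀ μ : ℂ, (A.map fun r => (r : ℂ)).charpoly.IsRoot μ → μ.re ≠ 0 :=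
      fun μ hμ => (hA μ hμ).ne
    have hspec' : ∀ μ : ℂ, ((-Aᵀ).map fun r => (r : ℂ)).charpoly.IsRoot μ → μ.re ≠ 0 :=
      fun μ hμ => (hA.re_pos_of_neg_transpose hμ).ne'
    have hxm : ∀ t ≥ (0 : ℝ), m ≤ ‖x (max t 0)‖ := fun t _ => (hbd' _ (le_max_right t 0)).1.1
    have hxM : ∀ t ≥ (0 : ℝ), ‖x (max t 0)‖ ≤ M := fun t _ => (hbd' _ (le_max_right t 0)).1.2
    have hlm : ∀ t ≥ (0 : ℝ), m ≤ ‖l (max t 0)‖ := fun t _ => (hbd' _ (le_max_right t 0)).2.1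
    have hlM : ∀ t ≥ (0 : ℝ), ‖l (max t 0)‖ ≤ M := fun t _ => (hbd' _ (le_max_right t 0)).2.2
    obtain ⟨t₁, ht₁, h₁⟩ := hL.exists_output_pos hspec' hk' hkc hm hlm hlM hT
    obtain ⟨t₂, ht₂, h₂⟩ := hL.neg.exists_output_pos hspec' hk' hkc hm
      (by simpa only [norm_neg] using hlm) (by simpa only [norm_neg] using hlM) hT
    obtain ⟨t₃, ht₃, h₃⟩ := hX.exists_output_pos hspec hk hkb hm hxm hxM hT
    obtain ⟨t₄, ht₄, h₄⟩ := hX.neg.exists_output_pos hspec hk hkb hm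
      (by simpa only [norm_neg] using hxm) (by simpa only [norm_neg] using hxM) hT
    rw [max_eq_left (hT.trans ht₁.le)] at h₁
    rw [inner_neg_right, max_eq_left (hT.trans ht₂.le), Left.neg_pos_iff] at h₂
    rw [max_eq_left (hT.trans ht₃.le)] at h₃
    rw [inner_neg_right, max_eq_left (hT.trans ht₄.le), Left.neg_pos_iff] at h₄
    exact ⟨⟨t₁, ht₁, h₁⟩, ⟨t₂, ht₂, h₂⟩, ⟨t₃, ht₃, h₃⟩, ⟨t₄, ht₄, h₄⟩⟩
end
end

section
/- Consider a Barabanov linear switched system with data A, b, c. Then every matrix of M = {A + u·b·cᵀ : u ∈ [0,1]} is Hurwitz: for every u ∈ [0,1], every complex eigenvalue of A + u·b·cᵀ has negative real part. -/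
open MeasureTheory Filter Topology RealInnerProductSpace Matrix

noncomputable section

/-- A solution that is multiplied by `exp (σ T)` over each period `T`, with `σ > 0`, contradicts
the vanishing of the largest Lyapunov exponent. -/
lemma IsBarabanovData.false_of_exp_growth {A : Matrix (Fin 3) (Fin 3) ℝ} {b c : Vec3}
    (hdata : IsBarabanovData A b c) {u : ℝ → ℝ} {x : ℝ → Vec3} (hx : IsBSolWith A b c u x)
    (hx0 : x 0 ≠ 0) {T σ : ℝ} (hT : 0 < T) (hσ : 0 < σ)
    (hper : ∀ n : ℕ, x (n * T) = Real.exp (σ * (n * T)) • x 0) : False := by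
  have hle := le_sSup (a := limsup (fun t => ((Real.log ‖x t‖ / t : ℝ) : EReal)) atTop)
    (show _ ∈ {r : EReal | ∃ u x, IsBSolWith A b c u x ∧ x 0 ≠ 0 ∧
      r = limsup (fun t => ((Real.log ‖x t‖ / t : ℝ) : EReal)) atTop} from ⟨u, x, hx, hx0, rfl⟩)
  rw [hdata.2.2.2.2] at hle
  have htend : Tendsto (fun n : ℕ => (n : ℝ) * T) atTop atTop :=
    tendsto_natCast_atTop_atTop.atTop_mul_const hT
  have hlim : Tendsto (fun n : ℕ => σ + Real.log ‖x 0‖ / (n * T)) atTop (𝓝 (σ + 0)) :=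
    tendsto_const_nhds.add (htend.const_div_atTop _)
  have hev : ∀ᶠ n : ℕ in atTop, σ / 2 < Real.log ‖x (n * T)‖ / (n * T) := by
    filter_upwards [hlim.eventually (lt_mem_nhds (show σ / 2 < σ + 0 by linarith)),
      eventually_gt_atTop 0] with n hn hn0
    have hnT : (n : ℝ) * T ≠ 0 := by positivity
    rw [hper n, norm_smul, Real.norm_eq_abs, Real.abs_exp,
      Real.log_mul (Real.exp_ne_zero _) (norm_ne_zero_iff.2 hx0), Real.log_exp, add_div,
      mul_div_cancel_right₀ _ hnT]
    exact hn
  have hfreq : ∃ᶠ t in atTop, ((σ / 2 : ℝ) : EReal) ≤ ((Real.log ‖x t‖ / t : ℝ) : EReal) :=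
    htend.frequently (hev.mono fun n hn => EReal.coe_le_coe_iff.2 hn.le).frequently
  have := (le_limsup_of_frequently_le' hfreq).trans hle
  have h2 : σ / 2 ≤ 0 := by exact_mod_cast this
  linarith

/-- Curves with the right derivative, for a continuous switching signal, are solutions. -/
lemma isBSolWith_of_hasDerivAt {A : Matrix (Fin 3) (Fin 3) ℝ} {b c : Vec3} {u : ℝ → ℝ}
    (hu : Continuous u) (hu01 : ∀ t, u t ∈ Set.Icc (0:ℝ) 1) {f : ℝ → Fin 3 → ℝ}
    (hf : ∀ t i, HasDerivAt (fun s => f s i)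
      (∑ j, A i j * f t j + u t * (∑ j, c j * f t j) * b i) t) :
    IsBSolWith A b c u (fun t => WithLp.toLp 2 (f t)) := by
  have hd : ∀ t, HasDerivAt (fun t => (WithLp.toLp 2 (f t) : Vec3))
      (mulE A (WithLp.toLp 2 (f t)) + (u t * ⟪c, WithLp.toLp 2 (f t)⟫) • b) t := by
    intro t
    have h := (PiLp.continuousLinearEquiv 2 ℝ (fun _ : Fin 3 => ℝ)).symm.hasFDerivAt.comp_hasDerivAt
      t (hasDerivAt_pi.2 (hf t))
    refine h.congr_deriv ?_
    ext i
    simp [mulE, Matrix.mulVec, dotProduct, PiLp.inner_apply, mul_comm]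
  have hc : Continuous (fun t => (WithLp.toLp 2 (f t) : Vec3)) :=
    continuous_iff_continuousAt.2 fun t => (hd t).continuousAt
  refine ⟨hu.measurable, hu01, hc.continuousOn, fun t _ => ?_⟩
  rw [intervalIntegral.integral_eq_sub_of_hasDerivAt (fun s _ => hd s)]
  · simp
  · refine Continuous.intervalIntegrable ?_ _ _
    have : Continuous (mulE A) := (Matrix.toEuclideanLin A).continuous_of_finiteDimensional
    fun_prop

lemma exists_period (ω : ℝ) :
    ∃ T > (0:ℝ), ∀ n : ℕ, Complex.exp (Complex.I * (ω * (n * T))) = 1 := by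
  by_cases h : ω = 0
  · exact ⟨1, one_pos, by simp [h]⟩
  have key : ∃ T > (0:ℝ), ∃ k : ℤ, ω * T = k * (2 * Real.pi) := by
    rcases lt_or_gt_of_ne h with h | h
    · exact ⟨2 * Real.pi / (-ω), by have := Real.pi_pos; have : 0 < -ω := by linarith
                                    positivity, -1, by push_cast; field_simp⟩
    · exact ⟨2 * Real.pi / ω, by positivity, 1, by push_cast; field_simp⟩
  obtain ⟨T, hT, k, hk⟩ := key
  refine ⟨T, hT, fun n => Complex.exp_eq_one_iff.2 ⟨n * k, ?_⟩⟩
  have hk' : (ω : ℂ) * T = k * (2 * Real.pi) := by exact_mod_cast hk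
  push_cast
  linear_combination (Complex.I * n) * hk'

/-- A nonzero superposition of the two modes of complex growth rates `σ + ω i` and `σ + 3 ω i`
cannot solve the system if `σ > 0`. -/
lemma IsBarabanovData.false_of_two_modes {A : Matrix (Fin 3) (Fin 3) ℝ} {b c : Vec3}
    (hdata : IsBarabanovData A b c) {u : ℝ → ℝ} (hu : Continuous u)
    (hu01 : ∀ t, u t ∈ Set.Icc (0:ℝ) 1) {σ ω : ℝ} (hσ : 0 < σ) (y z : Fin 3 → ℂ)
    (h0 : ∃ i, (y i + z i).re ≠ 0)
    (hode : ∀ (t : ℝ) i,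
      ((σ + ω * Complex.I) * (Complex.exp ((σ + ω * Complex.I) * t) * y i) +
        (σ + 3 * ω * Complex.I) * (Complex.exp ((σ + 3 * ω * Complex.I) * t) * z i)).re =
      ∑ j, A i j * (Complex.exp ((σ + ω * Complex.I) * t) * y j +
          Complex.exp ((σ + 3 * ω * Complex.I) * t) * z j).re +
        u t * (∑ j, c j * (Complex.exp ((σ + ω * Complex.I) * t) * y j +
          Complex.exp ((σ + 3 * ω * Complex.I) * t) * z j).re) * b i) : False := by
  obtain ⟨T, hT, hper⟩ := exists_period ω
  have hexp : ∀ (s : ℂ) (t : ℝ), HasDerivAt (fun t : ℝ => Complex.exp (s * t))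
      (s * Complex.exp (s * t)) t := by
    intro s t
    have h := ((Complex.ofRealCLM.hasDerivAt (x := t)).const_mul s).cexp
    simpa [mul_comm] using h
  refine hdata.false_of_exp_growth (isBSolWith_of_hasDerivAt hu hu01
    (f := fun t i => (Complex.exp ((σ + ω * Complex.I) * t) * y i +
      Complex.exp ((σ + 3 * ω * Complex.I) * t) * z i).re) ?_) ?_ hT hσ ?_
  · intro t i
    have h := (((hexp (σ + ω * Complex.I) t).mul_const (y i)).add
      ((hexp (σ + 3 * ω * Complex.I) t).mul_const (z i)))
    have h' := (Complex.reCLM.hasFDerivAt.comp_hasDerivAt t h)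
    refine h'.congr_deriv ?_
    rw [← hode t i]
    simp only [Complex.reCLM_apply, mul_assoc]
  · obtain ⟨i, hi⟩ := h0
    intro h
    apply hi
    simpa using congrArg (fun v : Vec3 => v i) h
  · intro n
    have e1 : Complex.exp ((σ + ω * Complex.I) * ((n * T : ℝ) : ℂ)) =
        (Real.exp (σ * (n * T)) : ℂ) := by
      rw [Complex.ofReal_exp, ← mul_one (Complex.exp ((σ * (n * T) : ℝ) : ℂ)), ← hper n,
        ← Complex.exp_add]
      congr 1; push_cast; ring
    have e3 : Complex.exp ((σ + 3 * ω * Complex.I) * ((n * T : ℝ) : ℂ)) =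
        (Real.exp (σ * (n * T)) : ℂ) := by
      have h3 : Complex.exp (Complex.I * (ω * (n * T))) ^ 3 = 1 := by rw [hper n, one_pow]
      rw [← Complex.exp_nat_mul] at h3
      rw [Complex.ofReal_exp, ← mul_one (Complex.exp ((σ * (n * T) : ℝ) : ℂ)), ← h3,
        ← Complex.exp_add]
      congr 1; push_cast; ring
    ext i
    simp only [e1, e3, PiLp.smul_apply, smul_eq_mul, ← mul_add, Complex.re_ofReal_mul]
    simp

lemma trig_modulation {P Q R S : ℂ} (hPR : P.im = R.im) (hQS : Q.im = S.im) {η : ℝ}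
    (hpos : 0 < Q.re - 3 * |S.re| - 4 * |Q.im|)
    (hbd : |P.re| + 3 * |R.re| + 4 * |P.im| ≤ η * (Q.re - 3 * |S.re| - 4 * |Q.im|)) :
    ∃ δ : ℝ → ℝ, Continuous δ ∧ (∀ θ, |δ θ| ≤ η) ∧
      ∀ θ : ℝ, (Complex.exp (θ * Complex.I) * P + Complex.exp ((3 * θ : ℝ) * Complex.I) * R).re =
        δ θ * (Complex.exp (θ * Complex.I) * Q + Complex.exp ((3 * θ : ℝ) * Complex.I) * S).re := by
  have hre : ∀ (X Y : ℂ) (θ : ℝ), X.im = Y.im →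
      (Complex.exp (θ * Complex.I) * X + Complex.exp ((3 * θ : ℝ) * Complex.I) * Y).re =
      Real.cos θ * (X.re + Y.re * (4 * Real.cos θ ^ 2 - 3)
        - X.im * (4 * (Real.sin θ * Real.cos θ))) := by
    intro X Y θ h
    simp only [Complex.add_re, Complex.mul_re, Complex.exp_ofReal_mul_I_re,
      Complex.exp_ofReal_mul_I_im, Real.cos_three_mul, Real.sin_three_mul, ← h]
    have := Real.sin_sq θ
    linear_combination (X.im * 4 * Real.sin θ) * this
  have h1 : ∀ θ, |4 * Real.cos θ ^ 2 - 3| ≤ 3 := fun θ => by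
    have := Real.cos_sq_le_one θ
    rw [abs_le]; constructor <;> nlinarith [sq_nonneg (Real.cos θ)]
  have h2 : ∀ θ, |4 * (Real.sin θ * Real.cos θ)| ≤ 4 := fun θ => by
    rw [abs_le]
    constructor <;> nlinarith [Real.sin_sq_add_cos_sq θ, sq_nonneg (Real.sin θ + Real.cos θ),
      sq_nonneg (Real.sin θ - Real.cos θ)]
  have hb1 : ∀ (r θ : ℝ), |r * (4 * Real.cos θ ^ 2 - 3)| ≤ 3 * |r| := fun r θ => by
    rw [abs_mul, mul_comm]; exact mul_le_mul_of_nonneg_right (h1 θ) (abs_nonneg r)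
  have hb2 : ∀ (r θ : ℝ), |r * (4 * (Real.sin θ * Real.cos θ))| ≤ 4 * |r| := fun r θ => by
    rw [abs_mul, mul_comm]; exact mul_le_mul_of_nonneg_right (h2 θ) (abs_nonneg r)
  have hW : ∀ θ, Q.re - 3 * |S.re| - 4 * |Q.im| ≤ Q.re + S.re * (4 * Real.cos θ ^ 2 - 3)
      - Q.im * (4 * (Real.sin θ * Real.cos θ)) := fun θ => by
    have := (abs_le.1 (hb1 S.re θ)).1
    have := (abs_le.1 (hb2 Q.im θ)).2
    linarith
  have hV : ∀ θ, |P.re + R.re * (4 * Real.cos θ ^ 2 - 3)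
      - P.im * (4 * (Real.sin θ * Real.cos θ))| ≤ |P.re| + 3 * |R.re| + 4 * |P.im| := fun θ => by
    have := abs_le.1 (hb1 R.re θ)
    have := abs_le.1 (hb2 P.im θ)
    have := neg_abs_le P.re
    have := le_abs_self P.re
    rw [abs_le]; constructor <;> linarith
  have hη : 0 ≤ η := by
    by_contra! h
    have : η * (Q.re - 3 * |S.re| - 4 * |Q.im|) < 0 := mul_neg_of_neg_of_pos h hpos
    have : 0 ≤ |P.re| + 3 * |R.re| + 4 * |P.im| := by positivity
    linarith
  refine ⟨fun θ => (P.re + R.re * (4 * Real.cos θ ^ 2 - 3)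
      - P.im * (4 * (Real.sin θ * Real.cos θ))) / (Q.re + S.re * (4 * Real.cos θ ^ 2 - 3)
      - Q.im * (4 * (Real.sin θ * Real.cos θ))), ?_, ?_, ?_⟩
  · refine Continuous.div (by fun_prop) (by fun_prop) fun θ => ?_
    exact (hpos.trans_le (hW θ)).ne'
  · intro θ
    have hWp := hpos.trans_le (hW θ)
    rw [abs_div, abs_of_pos hWp, div_le_iff₀ hWp]
    exact (hV θ).trans (hbd.trans (mul_le_mul_of_nonneg_left (hW θ) hη))
  · intro θ
    have hWp := (hpos.trans_le (hW θ)).ne'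
    have key : ∀ C V W : ℝ, W ≠ 0 → C * V = V / W * (C * W) := by intros; field_simp
    rw [hre P R θ hPR, hre Q S θ hQS]
    exact key _ _ _ hWp

/-- Parametric resonance: near a zero `ω i` of `p` at which `q` does not vanish, a small periodic
modulation sustains a motion of positive growth rate made of the harmonics `ω` and `3 ω`. -/
lemma exists_resonant_modulation {p q : ℂ → ℂ} (hp : Continuous p) (hq : Continuous q) {ω : ℝ}
    (hp1 : p (ω * Complex.I) = 0) (hq1 : q (ω * Complex.I) ≠ 0) (hp3 : p (3 * ω * Complex.I) ≠ 0)
    {η : ℝ} (hη : 0 < η) :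
    ∃ σ : ℝ, 0 < σ ∧ ∃ α β : ℂ, ∃ δ : ℝ → ℝ, Continuous δ ∧ (∀ θ, |δ θ| ≤ η) ∧
      (α * q (σ + ω * Complex.I) + β * q (σ + 3 * ω * Complex.I)).re ≠ 0 ∧
      ∀ θ : ℝ, (Complex.exp (θ * Complex.I) * (α * p (σ + ω * Complex.I)) +
          Complex.exp ((3 * θ : ℝ) * Complex.I) * (β * p (σ + 3 * ω * Complex.I))).re =
        δ θ * (Complex.exp (θ * Complex.I) * (α * q (σ + ω * Complex.I)) +
          Complex.exp ((3 * θ : ℝ) * Complex.I) * (β * q (σ + 3 * ω * Complex.I))).re := by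
  have l1 : ∀ {g : ℂ → ℂ}, Continuous g →
      Tendsto (fun σ : ℝ => g (σ + ω * Complex.I)) (𝓝 0) (𝓝 (g (ω * Complex.I))) := by
    intro g hg
    have : Continuous (fun σ : ℝ => g (σ + ω * Complex.I)) := by fun_prop
    simpa using this.tendsto 0
  have l3 : ∀ {g : ℂ → ℂ}, Continuous g →
      Tendsto (fun σ : ℝ => g (σ + 3 * ω * Complex.I)) (𝓝 0) (𝓝 (g (3 * ω * Complex.I))) := by
    intro g hg
    have : Continuous (fun σ : ℝ => g (σ + 3 * ω * Complex.I)) := by fun_prop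
    simpa using this.tendsto 0
  set h : ℝ → ℂ := fun σ => p (σ + ω * Complex.I) / q (σ + ω * Complex.I) with hh
  set g : ℝ → ℂ := fun σ => q (σ + 3 * ω * Complex.I) / p (σ + 3 * ω * Complex.I) with hg
  have th : Tendsto h (𝓝 0) (𝓝 0) := by
    have := (l1 hp).div (l1 hq) hq1
    rwa [hp1, zero_div] at this
  set g₀ := q (3 * ω * Complex.I) / p (3 * ω * Complex.I)
  have tg : Tendsto g (𝓝 0) (𝓝 g₀) := (l3 hq).div (l3 hp) hp3
  have re_t : ∀ {F : ℝ → ℂ} {z : ℂ}, Tendsto F (𝓝 0) (𝓝 z) →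
      Tendsto (fun σ => (F σ).re) (𝓝 0) (𝓝 z.re) := fun hF =>
    (Complex.continuous_re.tendsto _).comp hF
  have im_t : ∀ {F : ℝ → ℂ} {z : ℂ}, Tendsto F (𝓝 0) (𝓝 z) →
      Tendsto (fun σ => (F σ).im) (𝓝 0) (𝓝 z.im) := fun hF =>
    (Complex.continuous_im.tendsto _).comp hF
  have tden : Tendsto (fun σ => 1 - (g σ).re * (h σ).re) (𝓝 0) (𝓝 1) := by
    simpa using tendsto_const_nhds.sub ((re_t tg).mul (re_t th))
  set r : ℝ → ℝ := fun σ => (h σ).im / (1 - (g σ).re * (h σ).re)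
  have ofReal_t : ∀ {F : ℝ → ℝ} {y : ℝ}, Tendsto F (𝓝 0) (𝓝 y) →
      Tendsto (fun σ => (F σ : ℂ)) (𝓝 0) (𝓝 y) := fun hF =>
    (Complex.continuous_ofReal.tendsto _).comp hF
  have tr : Tendsto r (𝓝 0) (𝓝 0) := by
    have := (im_t th).div tden one_ne_zero
    rwa [Complex.zero_im, zero_div] at this
  have trc : Tendsto (fun σ => (r σ : ℂ)) (𝓝 0) (𝓝 0) := by
    simpa using ofReal_t tr
  set Q : ℝ → ℂ := fun σ => 1 + (r σ * (g σ).re : ℝ) * Complex.I with hQ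
  have tQ : Tendsto Q (𝓝 0) (𝓝 1) := by
    have : Tendsto (fun σ => ((r σ * (g σ).re : ℝ) : ℂ)) (𝓝 0) (𝓝 0) := by
      simpa using ofReal_t (tr.mul (re_t tg))
    simpa [hQ] using (this.mul_const Complex.I).const_add 1
  have tP : Tendsto (fun σ => Q σ * h σ) (𝓝 0) (𝓝 0) := by simpa using tQ.mul th
  set R : ℝ → ℂ := fun σ => r σ * Complex.I with hR
  have tR : Tendsto R (𝓝 0) (𝓝 0) := by simpa using trc.mul_const Complex.I
  have tS : Tendsto (fun σ => R σ * g σ) (𝓝 0) (𝓝 0) := by simpa using tR.mul tg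
  have tG : Tendsto (fun σ => (Q σ).re - 3 * |(R σ * g σ).re| - 4 * |(Q σ).im|) (𝓝 0) (𝓝 1) := by
    simpa using ((re_t tQ).sub ((re_t tS).abs.const_mul 3)).sub ((im_t tQ).abs.const_mul 4)
  have tF : Tendsto (fun σ => |(Q σ * h σ).re| + 3 * |(R σ).re| + 4 * |(Q σ * h σ).im|)
      (𝓝 0) (𝓝 0) := by
    simpa using ((re_t tP).abs.add ((re_t tR).abs.const_mul 3)).add ((im_t tP).abs.const_mul 4)
  have tG' := tG.const_mul η
  have hev : ∀ᶠ σ : ℝ in 𝓝 0, q (σ + ω * Complex.I) ≠ 0 ∧ p (σ + 3 * ω * Complex.I) ≠ 0 ∧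
      1 - (g σ).re * (h σ).re ≠ 0 ∧ 0 < (Q σ).re - 3 * |(R σ * g σ).re| - 4 * |(Q σ).im| ∧
      |(Q σ * h σ).re| + 3 * |(R σ).re| + 4 * |(Q σ * h σ).im| <
        η * ((Q σ).re - 3 * |(R σ * g σ).re| - 4 * |(Q σ).im|) := by
    filter_upwards [(l1 hq).eventually_ne hq1, (l3 hp).eventually_ne hp3,
      tden.eventually_ne one_ne_zero, tG.eventually (lt_mem_nhds one_pos),
      tF.eventually_lt tG' (by simpa using hη)] with σ a1 a2 a3 a4 a5
    exact ⟨a1, a2, a3, a4, a5⟩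
  obtain ⟨σ, ⟨hq1σ, hp3σ, hdσ, hGσ, hFσ⟩, hσ⟩ :=
    ((hev.filter_mono nhdsWithin_le_nhds).and (self_mem_nhdsWithin (s := Set.Ioi (0:ℝ)))).exists
  have eQ : Q σ / q (σ + ω * Complex.I) * q (σ + ω * Complex.I) = Q σ := div_mul_cancel₀ _ hq1σ
  have eR : R σ / p (σ + 3 * ω * Complex.I) * p (σ + 3 * ω * Complex.I) = R σ :=
    div_mul_cancel₀ _ hp3σ
  have eP : Q σ / q (σ + ω * Complex.I) * p (σ + ω * Complex.I) = Q σ * h σ := by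
    simp only [hh]; ring
  have eS : R σ / p (σ + 3 * ω * Complex.I) * q (σ + 3 * ω * Complex.I) = R σ * g σ := by
    simp only [hg]; ring
  have hrσ : r σ * (1 - (g σ).re * (h σ).re) = (h σ).im := div_mul_cancel₀ _ hdσ
  obtain ⟨δ, hδc, hδb, hδ⟩ := trig_modulation (P := Q σ * h σ) (Q := Q σ) (R := R σ)
    (S := R σ * g σ) (η := η)
    (by simp [hQ, hR]; linear_combination -hrσ) (by simp [hQ, hR]) hGσ hFσ.le
  refine ⟨σ, hσ, Q σ / q (σ + ω * Complex.I), R σ / p (σ + 3 * ω * Complex.I), δ, hδc, hδb, ?_, ?_⟩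
  · rw [eQ, eS, Complex.add_re]
    have := neg_abs_le (R σ * g σ).re
    have := abs_nonneg (R σ * g σ).re
    have := abs_nonneg (Q σ).im
    exact ne_of_gt (by linarith)
  · rw [eQ, eS, eP, eR]; exact hδ

/-- The pencil `s - A` over `ℂ`. -/
def pencil (A : Matrix (Fin 3) (Fin 3) ℝ) (s : ℂ) : Matrix (Fin 3) (Fin 3) ℂ :=
  Matrix.scalar (Fin 3) s - A.map (fun r => (r : ℂ))

/-- The vector `adj (s - A) b`. -/
def modeVec (A : Matrix (Fin 3) (Fin 3) ℝ) (b : Vec3) (s : ℂ) : Fin 3 → ℂ :=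
  (pencil A s).adjugate *ᵥ fun i => (b i : ℂ)

/-- The numerator `cᵀ adj (s - A) b` of the transfer function. -/
def transferNum (A : Matrix (Fin 3) (Fin 3) ℝ) (b c : Vec3) (s : ℂ) : ℂ :=
  ∑ j, (c j : ℂ) * modeVec A b s j

lemma isRoot_charpoly_iff (A : Matrix (Fin 3) (Fin 3) ℝ) (s : ℂ) :
    (A.map (fun r => (r : ℂ))).charpoly.IsRoot s ↔ (pencil A s).det = 0 := by
  rw [Polynomial.IsRoot, Matrix.eval_charpoly, pencil]

lemma smul_modeVec_sub (A : Matrix (Fin 3) (Fin 3) ℝ) (b : Vec3) (s : ℂ) (i : Fin 3) :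
    s * modeVec A b s i = ∑ j, (A i j : ℂ) * modeVec A b s j + (pencil A s).det * b i := by
  have h : pencil A s *ᵥ modeVec A b s = (pencil A s).det • fun i => (b i : ℂ) := by
    rw [modeVec, Matrix.mulVec_mulVec, Matrix.mul_adjugate, Matrix.smul_mulVec, Matrix.one_mulVec]
  have hi := congrFun h i
  simp only [pencil, Matrix.sub_mulVec, Pi.sub_apply, Pi.smul_apply, smul_eq_mul,
    Matrix.scalar_apply, Matrix.mulVec_diagonal] at hi ⊢
  rw [← hi]
  simp [Matrix.mulVec, dotProduct]

lemma det_pencil_add_smul (A : Matrix (Fin 3) (Fin 3) ℝ) (b c : Vec3) (u : ℝ) (s : ℂ) :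
    (pencil (A + u • bcMat b c) s).det = (pencil A s).det - u * transferNum A b c s := by
  simp only [transferNum, modeVec, Matrix.adjugate_fin_three, Matrix.det_fin_three, pencil, bcMat,
    Fin.sum_univ_three, Matrix.mulVec, dotProduct, Matrix.sub_apply, Matrix.map_apply,
    Matrix.add_apply, Matrix.smul_apply, Matrix.vecMulVec_apply, smul_eq_mul, Matrix.of_apply,
    Matrix.cons_val, Complex.ofReal_add, Complex.ofReal_mul]
  ring

lemma exists_det_pencil_eq (A : Matrix (Fin 3) (Fin 3) ℝ) :
    ∃ k₂ k₁ k₀ : ℝ, ∀ s : ℂ, (pencil A s).det = s ^ 3 + k₂ * s ^ 2 + k₁ * s + k₀ := by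
  refine ⟨-(A 0 0 + A 1 1 + A 2 2), A 0 0 * A 1 1 + A 0 0 * A 2 2 + A 1 1 * A 2 2
    - A 0 1 * A 1 0 - A 0 2 * A 2 0 - A 1 2 * A 2 1, -A.det, fun s => ?_⟩
  simp [Matrix.det_fin_three, pencil]
  ring

lemma continuous_pencil (A : Matrix (Fin 3) (Fin 3) ℝ) : Continuous (pencil A) := by
  refine continuous_matrix fun i j => ?_
  simp only [pencil, Matrix.sub_apply, Matrix.scalar_apply, Matrix.diagonal_apply]
  split_ifs <;> fun_prop

lemma continuous_transferNum (A : Matrix (Fin 3) (Fin 3) ℝ) (b c : Vec3) :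
    Continuous (transferNum A b c) := by
  have := (continuous_pencil A).matrix_adjugate
  have h2 : Continuous (modeVec A b) := this.matrix_mulVec continuous_const
  unfold transferNum
  fun_prop

lemma IsHurwitz.det_pencil_zero_pos {A : Matrix (Fin 3) (Fin 3) ℝ} (hA : IsHurwitz A) :
    ∃ d : ℝ, 0 < d ∧ (pencil A 0).det = d := by
  obtain ⟨k₂, k₁, k₀, h⟩ := exists_det_pencil_eq A
  refine ⟨k₀, ?_, by simp [h]⟩
  by_contra! hk
  have hcont : Continuous (fun t : ℝ => t ^ 3 + k₂ * t ^ 2 + k₁ * t + k₀) := by fun_prop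
  set M := 1 + |k₂| + |k₁| + |k₀| with hM
  have hM1 : 1 ≤ M := by
    have := abs_nonneg k₂; have := abs_nonneg k₁; have := abs_nonneg k₀; linarith
  have hMpos : 0 ≤ M ^ 3 + k₂ * M ^ 2 + k₁ * M + k₀ := by
    have e : M ^ 3 = M ^ 2 + |k₂| * M ^ 2 + |k₁| * M ^ 2 + |k₀| * M ^ 2 := by
      nth_rewrite 1 [pow_succ, hM]; ring
    have h2 := mul_nonneg (by linarith [neg_abs_le k₂] : 0 ≤ |k₂| + k₂) (sq_nonneg M)
    have h1 := mul_nonneg (by linarith [neg_abs_le k₁] : 0 ≤ |k₁| + k₁) (by linarith : 0 ≤ M)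
    have h0 := neg_abs_le k₀
    have h1' := mul_nonneg (abs_nonneg k₁) (by nlinarith : 0 ≤ M ^ 2 - M)
    have h0' := mul_nonneg (abs_nonneg k₀) (by nlinarith : 0 ≤ M ^ 2 - 1)
    nlinarith [sq_nonneg M]
  obtain ⟨t, ht, ht0⟩ := intermediate_value_Icc (show (0:ℝ) ≤ M by linarith) hcont.continuousOn
    (show (0:ℝ) ∈ Set.Icc _ _ from ⟨by simpa using hk, hMpos⟩)
  have := hA t ((isRoot_charpoly_iff A t).2 (by rw [h]; exact_mod_cast ht0))
  rw [Complex.ofReal_re] at this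
  linarith [ht.1]

lemma IsBarabanovData.false_of_re_pos {A : Matrix (Fin 3) (Fin 3) ℝ} {b c : Vec3}
    (hdata : IsBarabanovData A b c) {u : ℝ} (hu : u ∈ Set.Icc (0:ℝ) 1) {s : ℂ}
    (hs : (pencil (A + u • bcMat b c) s).det = 0) (hre : 0 < s.re) : False := by
  obtain ⟨v, hv0, hv⟩ := Matrix.exists_mulVec_eq_zero_iff.2 hs
  have key : ∃ w : Fin 3 → ℂ, pencil (A + u • bcMat b c) s *ᵥ w = 0 ∧ ∃ i, (w i).re ≠ 0 := by
    by_cases h : ∃ i, (v i).re ≠ 0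
    · exact ⟨v, hv, h⟩
    · push Not at h
      refine ⟨Complex.I • v, by rw [Matrix.mulVec_smul, hv, smul_zero], ?_⟩
      by_contra! h'
      refine hv0 (funext fun i => Complex.ext (h i) ?_)
      simpa using h' i
  obtain ⟨w, hw, hw0⟩ := key
  refine hdata.false_of_two_modes (u := fun _ => u) continuous_const (fun _ => hu) hre
    (ω := s.im) w 0 (by simpa using hw0) fun t i => ?_
  have hwi := congrFun hw i
  simp only [pencil, Matrix.sub_mulVec, Pi.sub_apply, Matrix.scalar_apply, Matrix.mulVec_diagonal,
    Pi.zero_apply] at hwi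
  simp only [Matrix.mulVec, dotProduct, Fin.sum_univ_three, Matrix.map_apply, Matrix.add_apply,
    Matrix.smul_apply, bcMat, Matrix.vecMulVec_apply, smul_eq_mul, Complex.ofReal_add,
    Complex.ofReal_mul] at hwi
  rw [Complex.re_add_im]
  set e := Complex.exp (s * t)
  have h2 := congrArg Complex.re (congrArg (fun z => e * z) hwi)
  simp [Fin.sum_univ_three] at h2 ⊢
  linear_combination h2

lemma IsBarabanovData.false_of_re_eq_zero {A : Matrix (Fin 3) (Fin 3) ℝ} {b c : Vec3}
    (hdata : IsBarabanovData A b c) {u : ℝ} (hu : u ∈ Set.Ioo (0:ℝ) 1) {ω : ℝ}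
    (hs : (pencil (A + u • bcMat b c) (ω * Complex.I)).det = 0) : False := by
  set B := A + u • bcMat b c with hB
  have hBA : ∀ s, (pencil A s).det = (pencil B s).det + u * transferNum B b c s := by
    intro s
    have h := det_pencil_add_smul B b c (-u) s
    have e : B + (-u) • bcMat b c = A := by rw [hB]; module
    rw [e] at h
    rw [h]; push_cast; ring
  have hω : ω ≠ 0 := by
    rintro rfl
    obtain ⟨d₀, hd₀, e₀⟩ := hdata.1.det_pencil_zero_pos
    obtain ⟨d₁, hd₁, e₁⟩ := hdata.2.1.det_pencil_zero_pos
    have a₁ := det_pencil_add_smul A b c 1 0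
    rw [one_smul, e₀, e₁] at a₁
    have a₂ := det_pencil_add_smul A b c u 0
    rw [← hB, e₀] at a₂
    rw [Complex.ofReal_zero, zero_mul, a₂] at hs
    have h : (((1 - u) * d₀ + u * d₁ : ℝ) : ℂ) = 0 := by
      push_cast at a₁ ⊢
      linear_combination hs + u * a₁
    have h' : (1 - u) * d₀ + u * d₁ = 0 := by exact_mod_cast h
    nlinarith [mul_pos (sub_pos.2 hu.2) hd₀, mul_pos hu.1 hd₁]
  have hq : transferNum B b c (ω * Complex.I) ≠ 0 := by
    intro hq
    have h := hBA (ω * Complex.I)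
    rw [hs, hq, mul_zero, add_zero] at h
    have := hdata.1 _ ((isRoot_charpoly_iff A _).2 h)
    simp at this
  have hp3 : (pencil B (3 * ω * Complex.I)).det ≠ 0 := by
    obtain ⟨k₂, k₁, k₀, h⟩ := exists_det_pencil_eq B
    rw [h] at hs ⊢
    intro h3
    have i1 := congrArg Complex.im hs
    have i3 := congrArg Complex.im h3
    simp [pow_succ] at i1 i3
    have : ω ^ 3 = 0 := by linear_combination (1 / 8) * i1 - (1 / 24) * i3
    exact hω (pow_eq_zero_iff (by norm_num) |>.1 this)
  obtain ⟨σ, hσ, α, β, δ, hδc, hδb, hne, hδ⟩ := exists_resonant_modulation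
    (continuous_pencil B).matrix_det (continuous_transferNum B b c) hs hq hp3
    (η := min u (1 - u)) (lt_min hu.1 (sub_pos.2 hu.2))
  refine hdata.false_of_two_modes (u := fun t => u + δ (ω * t)) (by fun_prop) (fun t => ?_) hσ
    (ω := ω) (fun i => α * modeVec B b (σ + ω * Complex.I) i)
    (fun i => β * modeVec B b (σ + 3 * ω * Complex.I) i) ?_ fun t i => ?_
  · have h := abs_le.1 (hδb (ω * t))
    have := min_le_left u (1 - u)
    have := min_le_right u (1 - u)
    constructor <;> linarith
  · by_contra! h
    apply hne
    have e : α * transferNum B b c (σ + ω * Complex.I) +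
        β * transferNum B b c (σ + 3 * ω * Complex.I) =
        ∑ j, (c j : ℂ) * (α * modeVec B b (σ + ω * Complex.I) j +
          β * modeVec B b (σ + 3 * ω * Complex.I) j) := by
      simp only [transferNum, Fin.sum_univ_three]; ring
    rw [e, Complex.re_sum]
    simp only [Complex.re_ofReal_mul, h, mul_zero, Finset.sum_const_zero]
  · have m1 := smul_modeVec_sub B b (σ + ω * Complex.I) i
    have m3 := smul_modeVec_sub B b (σ + 3 * ω * Complex.I) i
    have x1 : Complex.exp ((σ + ω * Complex.I) * t) =
        (Real.exp (σ * t) : ℂ) * Complex.exp ((ω * t : ℝ) * Complex.I) := by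
      rw [Complex.ofReal_exp, ← Complex.exp_add]; congr 1; push_cast; ring
    have x3 : Complex.exp ((σ + 3 * ω * Complex.I) * t) =
        (Real.exp (σ * t) : ℂ) * Complex.exp ((3 * (ω * t) : ℝ) * Complex.I) := by
      rw [Complex.ofReal_exp, ← Complex.exp_add]; congr 1; push_cast; ring
    have hδt := hδ (ω * t)
    rw [x1, x3]
    simp only [transferNum] at hδt
    set s₁ : ℂ := σ + ω * Complex.I
    set s₃ : ℂ := σ + 3 * ω * Complex.I
    set e₁ := Complex.exp ((ω * t : ℝ) * Complex.I)
    set e₃ := Complex.exp ((3 * (ω * t) : ℝ) * Complex.I)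
    set E := Real.exp (σ * t)
    set z₁ := modeVec B b s₁
    set z₃ := modeVec B b s₃
    set X : Fin 3 → ℂ := fun j => e₁ * (α * z₁ j) + e₃ * (β * z₃ j) with hX
    set p₁ := (pencil B s₁).det
    set p₃ := (pencil B s₃).det
    have hL : s₁ * (E * e₁ * (α * z₁ i)) + s₃ * (E * e₃ * (β * z₃ i)) =
        E * (∑ j, (B i j : ℂ) * X j + (b i : ℂ) * (e₁ * (α * p₁) + e₃ * (β * p₃))) := by
      simp only [Fin.sum_univ_three, hX] at m1 m3 ⊢
      linear_combination (E * e₁ * α) * m1 + (E * e₃ * β) * m3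
    have hR : ∀ j, (E * e₁ * (α * z₁ j) + E * e₃ * (β * z₃ j)).re = E * (X j).re := by
      intro j
      rw [← Complex.re_ofReal_mul]; congr 1; simp only [hX]; ring
    have hc : e₁ * (α * ∑ j, (c j : ℂ) * z₁ j) + e₃ * (β * ∑ j, (c j : ℂ) * z₃ j) =
        ∑ j, (c j : ℂ) * X j := by
      simp only [Fin.sum_univ_three, hX]; ring
    rw [hc, Complex.re_sum] at hδt
    simp only [Complex.re_ofReal_mul] at hδt
    rw [hL, Complex.re_ofReal_mul, Complex.add_re, Complex.re_sum, Complex.re_ofReal_mul, hδt]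
    simp only [Complex.re_ofReal_mul, hR, Fin.sum_univ_three, hB, Matrix.add_apply,
      Matrix.smul_apply, bcMat, Matrix.vecMulVec_apply, smul_eq_mul]
    ring

theorem stmt17 (A : Matrix (Fin 3) (Fin 3) ℝ) (b c : Vec3)
    (hdata : IsBarabanovData A b c) :
    ∀ u ∈ Set.Icc (0:ℝ) 1, IsHurwitz (A + u • bcMat b c) := by
  intro u hu μ hμ
  rcases hu.1.eq_or_lt with rfl | hu0
  · rw [zero_smul, add_zero] at hμ
    exact hdata.1 μ hμ
  rcases hu.2.eq_or_lt with rfl | hu1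
  · rw [one_smul] at hμ
    exact hdata.2.1 μ hμ
  rw [isRoot_charpoly_iff] at hμ
  by_contra! h
  rcases h.eq_or_lt with h0 | hpos
  · refine hdata.false_of_re_eq_zero ⟨hu0, hu1⟩ (ω := μ.im) ?_
    have e : (μ.im : ℂ) * Complex.I = μ := by
      apply Complex.ext <;> simp [← h0]
    rw [e]; exact hμ
  · exact hdata.false_of_re_pos hu hμ hpos
end
end
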